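/- Let m ≥ n ≥ 1 be integers and let S_{n,m} be the bistar obtained from two adjacent vertices x and y by attaching m leaves to x and n leaves to y. Then μ_2(S_{n,m}) = m + 1 and μ_3(S_{n,m}) = n + m. -/

import Mathlib

open SimpleGraph

/-- Two vertices `x, y` are `S_k`-visible in `G`: there is a shortest `x,y`-path of length
at most `k` none of whose internal vertices lies in `S`. -/
def SKVisible {V : Type*} (G : SimpleGraph V) (S : Set V) (k : ℕ) (x y : V) : Prop :=
  ∃ p : G.Walk x y, p.IsPath ∧ p.length = G.dist x y ∧ p.length ≤ k ∧
    ∀ v ∈ p.support, v ∈ S → v = x ∨ v = y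

/-- `S` is a `k`-distance mutual-visibility set of `G`. -/
def IsKDistMutualVisSet {V : Type*} (G : SimpleGraph V) (k : ℕ) (S : Set V) : Prop :=
  ∀ ⦃x⦄, x ∈ S → ∀ ⦃y⦄, y ∈ S → SKVisible G S k x y

/-- The `k`-distance mutual-visibility number `μ_k(G)`. -/
noncomputable def kdistMu {V : Type*} (G : SimpleGraph V) (k : ℕ) : ℕ :=
  sSup {n | ∃ S : Finset V, IsKDistMutualVisSet G k ↑S ∧ S.card = n}

/-- Two vertices `x, y` are `S`-visible in `G`. -/
def SVisible {V : Type*} (G : SimpleGraph V) (S : Set V) (x y : V) : Prop :=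
  ∃ p : G.Walk x y, p.IsPath ∧ p.length = G.dist x y ∧
    ∀ v ∈ p.support, v ∈ S → v = x ∨ v = y

/-- `S` is a mutual-visibility set of `G`. -/
def IsMutualVisSet {V : Type*} (G : SimpleGraph V) (S : Set V) : Prop :=
  ∀ ⦃x⦄, x ∈ S → ∀ ⦃y⦄, y ∈ S → SVisible G S x y

/-- The mutual-visibility number `μ(G)`. -/
noncomputable def mutualVisNum {V : Type*} (G : SimpleGraph V) : ℕ :=
  sSup {n | ∃ S : Finset V, IsMutualVisSet G ↑S ∧ S.card = n}

/-- The bistar `S_{n,m}`: two adjacent centers, the first (`Sum.inl (Sum.inl ())`) with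
`m` leaves, the second (`Sum.inl (Sum.inr ())`) with `n` leaves. -/
def bistar (n m : ℕ) : SimpleGraph ((Unit ⊕ Unit) ⊕ (Fin m ⊕ Fin n)) :=
  SimpleGraph.fromRel (fun a b =>
    (a = Sum.inl (Sum.inl ()) ∧ b = Sum.inl (Sum.inr ())) ∨
    (∃ i : Fin m, a = Sum.inl (Sum.inl ()) ∧ b = Sum.inr (Sum.inl i)) ∨
    (∃ j : Fin n, a = Sum.inl (Sum.inr ()) ∧ b = Sum.inr (Sum.inr j)))

namespace SKVisible

variable {V : Type*} {G : SimpleGraph V} {S : Set V} {k : ℕ} {u v w : V}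

theorem refl (G : SimpleGraph V) (S : Set V) (k : ℕ) (v : V) : SKVisible G S k v v :=
  ⟨.nil, .nil, by simp, by simp, by simp⟩

theorem symm (h : SKVisible G S k u v) : SKVisible G S k v u := by
  obtain ⟨p, hp, hd, hk, hS⟩ := h
  refine ⟨p.reverse, hp.reverse, by rw [Walk.length_reverse, hd, dist_comm],
    by rwa [Walk.length_reverse], fun z hz hzS => (hS z ?_ hzS).symm⟩
  simpa using hz

theorem of_forall_length_le (p : G.Walk u v) (hp : ∀ q : G.Walk u v, p.length ≤ q.length)
    (hk : p.length ≤ k) (hS : ∀ z ∈ p.support, z ∈ S → z = u ∨ z = v) :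
    SKVisible G S k u v := by
  obtain ⟨q, hq⟩ := p.reachable.exists_walk_length_eq_dist
  have hd : p.length = G.dist u v := le_antisymm (hq ▸ hp q) (dist_le p)
  exact ⟨p, p.isPath_of_length_eq_dist hd, hd, hk, hS⟩

/-- Distinct nonadjacent vertices with a common neighbour outside `S` see each other. -/
theorem of_common_neighbor (hu : G.Adj u w) (hv : G.Adj w v) (huv : u ≠ v)
    (hadj : ¬ G.Adj u v) (hw : w ∉ S) (hk : 2 ≤ k) : SKVisible G S k u v := by
  refine of_forall_length_le (.cons hu (.cons hv .nil)) (fun q => ?_) (by simpa using hk) ?_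
  · rcases q with _ | ⟨h, _ | ⟨_, _⟩⟩
    · exact absurd rfl huv
    · exact absurd h hadj
    · simp
  · intro z hz hzS
    simp only [Walk.support_cons, Walk.support_nil, List.mem_cons, List.not_mem_nil,
      or_false] at hz
    rcases hz with rfl | rfl | rfl
    · exact .inl rfl
    · exact absurd hzS hw
    · exact .inr rfl

/-- A pendant vertex sees at most its only neighbour `w` when `w ∈ S`. -/
theorem eq_of_pendant (h : SKVisible G S k u v) (hpend : ∀ z, G.Adj u z → z = w)
    (huw : u ≠ w) (hw : w ∈ S) : v = u ∨ v = w := by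
  obtain ⟨p, -, -, -, hS⟩ := h
  rcases p with _ | ⟨ha, q⟩
  · exact .inl rfl
  · obtain rfl := hpend _ ha
    rcases hS _ (List.mem_cons_of_mem _ q.start_mem_support) hw with h | h
    · exact absurd h.symm huw
    · exact .inr h.symm

end SKVisible

theorem IsKDistMutualVisSet.card_le_two_of_pendant {V : Type*} [DecidableEq V]
    {G : SimpleGraph V} {S : Finset V} {k : ℕ} {u w : V} (hS : IsKDistMutualVisSet G k ↑S)
    (hpend : ∀ z, G.Adj u z → z = w) (huw : u ≠ w) (hu : u ∈ S) (hw : w ∈ S) :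
    S.card ≤ 2 := by
  refine (Finset.card_le_card (t := {u, w}) fun v hv => ?_).trans Finset.card_le_two
  simpa using (hS hu hv).eq_of_pendant hpend huw hw

theorem kdistMu_eq {V : Type*} {G : SimpleGraph V} {k : ℕ} {S : Finset V}
    (hS : IsKDistMutualVisSet G k ↑S)
    (hmax : ∀ T : Finset V, IsKDistMutualVisSet G k ↑T → T.card ≤ S.card) :
    kdistMu G k = S.card :=
  IsGreatest.csSup_eq ⟨⟨S, hS, rfl⟩, by rintro _ ⟨T, hT, rfl⟩; exact hmax T hT⟩

namespace bistar

variable {n m k : ℕ}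

/-- The leaves attached to the first center. -/
def leftLeaves (n m : ℕ) : Finset ((Unit ⊕ Unit) ⊕ (Fin m ⊕ Fin n)) :=
  Finset.univ.image fun i => .inr (.inl i)

/-- The leaves attached to the second center. -/
def rightLeaves (n m : ℕ) : Finset ((Unit ⊕ Unit) ⊕ (Fin m ⊕ Fin n)) :=
  Finset.univ.image fun j => .inr (.inr j)

theorem card_leftLeaves : (leftLeaves n m).card = m :=
  (Finset.card_image_of_injective _ (Sum.inr_injective.comp Sum.inl_injective)).trans
    (Finset.card_fin _)

theorem card_rightLeaves : (rightLeaves n m).card = n :=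
  (Finset.card_image_of_injective _ (Sum.inr_injective.comp Sum.inr_injective)).trans
    (Finset.card_fin _)

theorem eq_of_adj_left {i : Fin m} {z} (h : (bistar n m).Adj (.inr (.inl i)) z) :
    z = .inl (.inl ()) := by
  simp [bistar] at h
  exact h.2

theorem eq_of_adj_right {j : Fin n} {z} (h : (bistar n m).Adj (.inr (.inr j)) z) :
    z = .inl (.inr ()) := by
  simp [bistar] at h
  exact h.2

theorem adj_left (i : Fin m) : (bistar n m).Adj (.inr (.inl i)) (.inl (.inl ())) := by
  simp [bistar]

theorem adj_right (j : Fin n) : (bistar n m).Adj (.inr (.inr j)) (.inl (.inr ())) := by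
  simp [bistar]

theorem adj_centers : (bistar n m).Adj (.inl (.inl ())) (.inl (.inr ())) := by
  simp [bistar]

theorem three_le_length {i : Fin m} {j : Fin n}
    (p : (bistar n m).Walk (.inr (.inl i)) (.inr (.inr j))) : 3 ≤ p.length := by
  match p with
  | .cons h .nil => cases eq_of_adj_left h
  | .cons h (.cons h' .nil) =>
    cases eq_of_adj_left h
    cases eq_of_adj_right h'.symm
  | .cons _ (.cons _ (.cons _ _)) => simp

theorem visible_left {S : Set ((Unit ⊕ Unit) ⊕ (Fin m ⊕ Fin n))}
    (hS : .inl (.inl ()) ∉ S) (hk : 2 ≤ k) (i i' : Fin m) :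
    SKVisible (bistar n m) S k (.inr (.inl i)) (.inr (.inl i')) := by
  rcases eq_or_ne i i' with rfl | hne
  · exact .refl ..
  · exact .of_common_neighbor (adj_left i) (adj_left i').symm (by simpa using hne)
      (fun h => by cases eq_of_adj_left h) hS hk

theorem visible_right {S : Set ((Unit ⊕ Unit) ⊕ (Fin m ⊕ Fin n))}
    (hS : .inl (.inr ()) ∉ S) (hk : 2 ≤ k) (j j' : Fin n) :
    SKVisible (bistar n m) S k (.inr (.inr j)) (.inr (.inr j')) := by
  rcases eq_or_ne j j' with rfl | hne
  · exact .refl ..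
  · exact .of_common_neighbor (adj_right j) (adj_right j').symm (by simpa using hne)
      (fun h => by cases eq_of_adj_right h) hS hk

theorem visible_left_center {S : Set ((Unit ⊕ Unit) ⊕ (Fin m ⊕ Fin n))}
    (hS : .inl (.inl ()) ∉ S) (hk : 2 ≤ k) (i : Fin m) :
    SKVisible (bistar n m) S k (.inr (.inl i)) (.inl (.inr ())) :=
  .of_common_neighbor (adj_left i) adj_centers (by simp)
    (fun h => by cases eq_of_adj_left h) hS hk

theorem visible_left_right {S : Set ((Unit ⊕ Unit) ⊕ (Fin m ⊕ Fin n))}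
    (hx : .inl (.inl ()) ∉ S) (hy : .inl (.inr ()) ∉ S) (hk : 3 ≤ k) (i : Fin m) (j : Fin n) :
    SKVisible (bistar n m) S k (.inr (.inl i)) (.inr (.inr j)) := by
  refine .of_forall_length_le
    (.cons (adj_left i) (.cons adj_centers (.cons (adj_right j).symm .nil)))
    three_le_length hk fun z hz hzS => ?_
  simp only [Walk.support_cons, Walk.support_nil, List.mem_cons, List.not_mem_nil,
    or_false] at hz
  rcases hz with rfl | rfl | rfl | rfl
  · exact .inl rfl
  · exact absurd hzS hx
  · exact absurd hzS hy
  · exact .inr rfl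

theorem isKDistMutualVisSet_insert_leftLeaves (hk : 2 ≤ k) :
    IsKDistMutualVisSet (bistar n m) k ↑(insert (.inl (.inr ())) (leftLeaves n m)) := by
  have hx : Sum.inl (Sum.inl ()) ∉
      (↑(insert (.inl (.inr ())) (leftLeaves n m)) : Set ((Unit ⊕ Unit) ⊕ (Fin m ⊕ Fin n))) := by
    simp [leftLeaves]
  rintro ((_ | _) | (i | i)) hu ((_ | _) | (j | j)) hv
  all_goals first
    | exact .refl ..
    | exact visible_left hx hk _ _
    | exact visible_left_center hx hk _
    | exact (visible_left_center hx hk _).symm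
    | simp [leftLeaves] at hu hv

theorem isKDistMutualVisSet_leaves (hk : 3 ≤ k) :
    IsKDistMutualVisSet (bistar n m) k ↑(leftLeaves n m ∪ rightLeaves n m) := by
  have hx : Sum.inl (Sum.inl ()) ∉
      (↑(leftLeaves n m ∪ rightLeaves n m) : Set ((Unit ⊕ Unit) ⊕ (Fin m ⊕ Fin n))) := by
    simp [leftLeaves, rightLeaves]
  have hy : Sum.inl (Sum.inr ()) ∉
      (↑(leftLeaves n m ∪ rightLeaves n m) : Set ((Unit ⊕ Unit) ⊕ (Fin m ⊕ Fin n))) := by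
    simp [leftLeaves, rightLeaves]
  rintro ((_ | _) | (i | i)) hu ((_ | _) | (j | j)) hv
  all_goals first
    | exact visible_left hx (by omega) _ _
    | exact visible_right hy (by omega) _ _
    | exact visible_left_right hx hy hk _ _
    | exact (visible_left_right hx hy hk _ _).symm
    | simp [leftLeaves, rightLeaves] at hu hv

theorem card_insert_leftLeaves :
    (insert (.inl (.inr ())) (leftLeaves n m)).card = m + 1 := by
  rw [Finset.card_insert_of_notMem (by simp [leftLeaves]), card_leftLeaves]

theorem card_leaves : (leftLeaves n m ∪ rightLeaves n m).card = n + m := by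
  rw [Finset.card_union_of_disjoint, card_leftLeaves, card_rightLeaves, add_comm]
  simp [Finset.disjoint_left, leftLeaves, rightLeaves]

theorem card_le_two_or_subset {S : Finset ((Unit ⊕ Unit) ⊕ (Fin m ⊕ Fin n))}
    (hS : IsKDistMutualVisSet (bistar n m) k ↑S) :
    S.card ≤ 2 ∨ S ⊆ insert (.inl (.inr ())) (leftLeaves n m) ∨
      S ⊆ insert (.inl (.inl ())) (rightLeaves n m) ∨ S ⊆ leftLeaves n m ∪ rightLeaves n m := by
  by_cases hx : Sum.inl (Sum.inl ()) ∈ S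
  · by_cases hl : ∃ i, Sum.inr (Sum.inl i) ∈ S
    · obtain ⟨i, hi⟩ := hl
      exact .inl (hS.card_le_two_of_pendant (fun _ => eq_of_adj_left) (by simp) hi hx)
    by_cases hy : Sum.inl (Sum.inr ()) ∈ S
    · by_cases hr : ∃ j, Sum.inr (Sum.inr j) ∈ S
      · obtain ⟨j, hj⟩ := hr
        exact .inl (hS.card_le_two_of_pendant (fun _ => eq_of_adj_right) (by simp) hj hy)
      refine .inl ((Finset.card_le_card (t := {.inl (.inl ()), .inl (.inr ())}) ?_).trans
        Finset.card_le_two)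
      rintro ((_ | _) | (i | i)) hi <;> simp_all
    · refine .inr (.inr (.inl ?_))
      rintro ((_ | _) | (i | i)) hi <;> simp_all [rightLeaves]
  · by_cases hy : Sum.inl (Sum.inr ()) ∈ S
    · by_cases hr : ∃ j, Sum.inr (Sum.inr j) ∈ S
      · obtain ⟨j, hj⟩ := hr
        exact .inl (hS.card_le_two_of_pendant (fun _ => eq_of_adj_right) (by simp) hj hy)
      refine .inr (.inl ?_)
      rintro ((_ | _) | (i | i)) hi <;> simp_all [leftLeaves]
    · refine .inr (.inr (.inr ?_))
      rintro ((_ | _) | (i | i)) hi <;> simp_all [leftLeaves, rightLeaves]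

theorem subset_leftLeaves_or_rightLeaves {S : Finset ((Unit ⊕ Unit) ⊕ (Fin m ⊕ Fin n))}
    (hS : IsKDistMutualVisSet (bistar n m) 2 ↑S) (h : S ⊆ leftLeaves n m ∪ rightLeaves n m) :
    S ⊆ leftLeaves n m ∨ S ⊆ rightLeaves n m := by
  by_contra! hc
  obtain ⟨u, hu, hul⟩ := Finset.not_subset.1 hc.1
  obtain ⟨v, hv, hvr⟩ := Finset.not_subset.1 hc.2
  obtain ⟨j, -, rfl⟩ := Finset.mem_image.1 ((Finset.mem_union.1 (h hu)).resolve_left hul)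
  obtain ⟨i, -, rfl⟩ := Finset.mem_image.1 ((Finset.mem_union.1 (h hv)).resolve_right hvr)
  obtain ⟨p, -, -, hp, -⟩ := hS hv hu
  exact absurd (three_le_length p) (by omega)

theorem card_insert_rightLeaves_le :
    (insert (.inl (.inl ())) (rightLeaves n m)).card ≤ n + 1 :=
  (Finset.card_insert_le ..).trans (by rw [card_rightLeaves])

end bistar

/-- For `m ≥ n ≥ 1`, `μ_2(S_{n,m}) = m + 1` and `μ_3(S_{n,m}) = n + m`. -/
theorem stmt7 (n m : ℕ) (hn : 1 ≤ n) (hnm : n ≤ m) :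
    kdistMu (bistar n m) 2 = m + 1 ∧ kdistMu (bistar n m) 3 = n + m := by
  constructor
  · rw [kdistMu_eq (bistar.isKDistMutualVisSet_insert_leftLeaves le_rfl) fun T hT => ?_,
      bistar.card_insert_leftLeaves]
    rw [bistar.card_insert_leftLeaves]
    rcases bistar.card_le_two_or_subset hT with h | h | h | h
    · omega
    · exact (Finset.card_le_card h).trans bistar.card_insert_leftLeaves.le
    · have := (Finset.card_le_card h).trans bistar.card_insert_rightLeaves_le
      omega
    · rcases bistar.subset_leftLeaves_or_rightLeaves hT h with h | h
      · have := (Finset.card_le_card h).trans bistar.card_leftLeaves.le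
        omega
      · have := (Finset.card_le_card h).trans bistar.card_rightLeaves.le
        omega
  · rw [kdistMu_eq (bistar.isKDistMutualVisSet_leaves le_rfl) fun T hT => ?_, bistar.card_leaves]
    rw [bistar.card_leaves]
    rcases bistar.card_le_two_or_subset hT with h | h | h | h
    · omega
    · have := (Finset.card_le_card h).trans bistar.card_insert_leftLeaves.le
      omega
    · have := (Finset.card_le_card h).trans bistar.card_insert_rightLeaves_le
      omega
    · exact (Finset.card_le_card h).trans bistar.card_leaves.le
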